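/- Let m and n be integers with 1 ≤ n ≤ m and let q ∈ (0,1). Then (1/2) Σ_B |π_{m,n,q}(B) − π_{∞,n,q}(B)| ≤ m · q^{m−n+1}, where the sum ranges over all finite n-element subsets B ⊆ ℕ. (That is, the total variation distance between the stationary distribution of the bounded geometric juggler's exclusion process and that of the unbounded geometric juggler's exclusion process is at most m·q^ℓ, where ℓ = m−n+1 is the number of vacant throw heights.) -/

import Mathlib

noncomputable section

/-- The `q`-analogue `[k]_q = (1 - q^k)/(1 - q)` of a natural number `k`. -/
def qAnalogue (q : ℝ) (k : ℕ) : ℝ := (1 - q ^ k) / (1 - q)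

/-- The `q`-Stirling numbers of the second kind `S_q[a,b]`. -/
def qStirling (q : ℝ) : ℕ → ℕ → ℝ
  | 0, 0 => 1
  | 0, _ + 1 => 0
  | _ + 1, 0 => 0
  | a + 1, b + 1 => q ^ b * qStirling q a b + qAnalogue q (b + 1) * qStirling q a (b + 1)

/-- The normalization constant `Z(m,n,q) = q^(C(m+1,2) - n) * S_{1/q}[m+1, m-n+1]`. -/
def Zval (m n : ℕ) (q : ℝ) : ℝ :=
  q ^ (((m + 1).choose 2 : ℤ) - (n : ℤ)) * qStirling (1 / q) (m + 1) (m - n + 1)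

/-- `v_B(x) = |{x, x+1, ..., m-1} \ B|`. -/
def vB (m : ℕ) (B : Finset ℕ) (x : ℕ) : ℕ := ((Finset.Ico x m) \ B).card

/-- The stationary weight `W_{m,q}(B) = ∏_{x ∈ B} [1 + v_B(x)]_q * q^x`. -/
def W (m : ℕ) (q : ℝ) (B : Finset ℕ) : ℝ :=
  ∏ x ∈ B, qAnalogue q (1 + vB m B x) * q ^ x

/-- The stationary distribution of the bounded geometric JEP, viewed as a distribution
on all finite subsets of `ℕ`: `π_{m,n,q}(B) = W_{m,q}(B)/Z(m,n,q)` for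
`B ⊆ {0,...,m-1}` and `0` otherwise. -/
def piBdd (m n : ℕ) (q : ℝ) (B : Finset ℕ) : ℝ :=
  if B ⊆ Finset.range m then W m q B / Zval m n q else 0

/-- The stationary distribution of the unbounded geometric JEP:
`π_{∞,n,q}(B) = (q;q)_n * q^(-C(n,2)) * ∏_{x ∈ B} q^x`. -/
def piUnbdd (n : ℕ) (q : ℝ) (B : Finset ℕ) : ℝ :=
  (∏ k ∈ Finset.Icc 1 n, (1 - q ^ k)) * q ^ (-(n.choose 2 : ℤ)) * ∏ x ∈ B, q ^ x

namespace JEP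

/-- shift down -/
def sg (B : Finset ℕ) : Finset ℕ := B.preimage Nat.succ (Nat.succ_injective.injOn)
/-- shift up -/
def up (B : Finset ℕ) : Finset ℕ := B.image Nat.succ
/-- shift up and add 0 -/
def up1 (B : Finset ℕ) : Finset ℕ := insert 0 (up B)

lemma mem_sg (B : Finset ℕ) (x : ℕ) : x ∈ sg B ↔ x + 1 ∈ B := by simp [sg]
lemma zero_up (B : Finset ℕ) : 0 ∉ up B := by simp [up]
lemma succ_up (B : Finset ℕ) (x : ℕ) : x + 1 ∈ up B ↔ x ∈ B := by simp [up]
lemma zero_up1 (B : Finset ℕ) : 0 ∈ up1 B := by simp [up1]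
lemma succ_up1 (B : Finset ℕ) (x : ℕ) : x + 1 ∈ up1 B ↔ x ∈ B := by simp [up1, succ_up]
lemma sg_up (B : Finset ℕ) : sg (up B) = B := by ext x; simp [mem_sg, succ_up]
lemma sg_up1 (B : Finset ℕ) : sg (up1 B) = B := by ext x; simp [mem_sg, succ_up1]
lemma up_sg (B : Finset ℕ) (h : 0 ∉ B) : up (sg B) = B := by
  ext x; cases x <;> simp [zero_up, succ_up, mem_sg, h]
lemma up1_sg (B : Finset ℕ) (h : 0 ∈ B) : up1 (sg B) = B := by
  ext x; cases x <;> simp [zero_up1, succ_up1, mem_sg, h]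
lemma sg_ins (B : Finset ℕ) (x : ℕ) : sg (insert (x + 1) B) = insert x (sg B) := by
  ext y; simp [mem_sg]
lemma sg_ins0 (B : Finset ℕ) : sg (insert 0 B) = sg B := by
  ext y; simp [mem_sg]
lemma card_up (B : Finset ℕ) : (up B).card = B.card :=
  Finset.card_image_of_injective _ Nat.succ_injective
lemma card_up1 (B : Finset ℕ) : (up1 B).card = B.card + 1 := by
  rw [up1, Finset.card_insert_of_notMem (zero_up B), card_up]
lemma up_ins (B : Finset ℕ) (x : ℕ) : up (insert x B) = insert (x+1) (up B) := by
  ext y; cases y <;> simp [zero_up, succ_up]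
lemma up1_ins (B : Finset ℕ) (x : ℕ) : up1 (insert x B) = insert (x+1) (up1 B) := by
  ext y; cases y <;> simp [zero_up1, succ_up1]
lemma up1_eq (B : Finset ℕ) : insert 0 (up B) = up1 B := rfl

/-- number of vacancies below x -/
def vac (B : Finset ℕ) : ℕ → ℕ
  | 0 => 0
  | x + 1 => vac B x + if x ∈ B then 0 else 1

lemma vac_shift (B : Finset ℕ) (x : ℕ) :
    vac B (x + 1) = vac (sg B) x + if 0 ∈ B then 0 else 1 := by
  induction x with
  | zero => simp [vac]
  | succ x ih => rw [vac, ih, vac]; simp only [mem_sg]; ring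

lemma vac_add (B : Finset ℕ) (x : ℕ) : vac B x + (B.filter (· < x)).card = x := by
  induction x with
  | zero => simp [vac]
  | succ x ih =>
    rw [vac]
    by_cases h : x ∈ B
    · have : B.filter (· < x + 1) = insert x (B.filter (· < x)) := by
        ext y; simp only [Finset.mem_filter, Finset.mem_insert]
        constructor
        · rintro ⟨h1, h2⟩
          by_cases e : y = x
          · exact Or.inl e
          · exact Or.inr ⟨h1, by omega⟩
        · rintro (rfl | ⟨h1, h2⟩)
          · exact ⟨h, by omega⟩
          · exact ⟨h1, by omega⟩
      rw [this, Finset.card_insert_of_notMem (by simp)]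
      simp [h]; omega
    · have : B.filter (· < x + 1) = B.filter (· < x) := by
        ext y; simp only [Finset.mem_filter]
        constructor
        · rintro ⟨h1, h2⟩
          have : y ≠ x := fun e => h (e ▸ h1)
          exact ⟨h1, by omega⟩
        · rintro ⟨h1, h2⟩
          exact ⟨h1, by omega⟩
      rw [this]; simp [h]; omega

lemma vac_sub (B : Finset ℕ) (M : ℕ) (h : B ⊆ Finset.range M) : vac B M + B.card = M := by
  have := vac_add B M
  rwa [Finset.filter_true_of_mem (fun x hx => by simpa using h hx)] at this

lemma vac_congr (B C : Finset ℕ) (x : ℕ) (h : ∀ y < x, y ∈ B ↔ y ∈ C) : vac B x = vac C x := by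
  induction x with
  | zero => rfl
  | succ x ih =>
    rw [vac, vac, ih (fun y hy => h y (by omega))]
    simp [h x (by omega)]

/-- throw weight -/
def t (q : ℝ) (B : Finset ℕ) (x : ℕ) : ℝ := if x ∈ B then 0 else (1 - q) * q ^ vac B x

/-- throw operator -/
def T (q : ℝ) (φ : Finset ℕ → ℝ) (B : Finset ℕ) : ℝ := ∑' x, t q B x * φ (insert x B)

/-- unbounded step -/
def K (q : ℝ) (φ : Finset ℕ → ℝ) (B : Finset ℕ) : ℝ :=
  if 0 ∈ B then T q φ (sg B) else φ (sg B)

lemma t_nonneg {q : ℝ} (h0 : 0 < q) (h1 : q < 1) (B : Finset ℕ) (x : ℕ) : 0 ≤ t q B x := by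
  unfold t
  split_ifs
  · rfl
  · have : 0 ≤ 1 - q := by linarith
    positivity

lemma t_sum {q : ℝ} (B : Finset ℕ) (M : ℕ) : ∑ x ∈ Finset.range M, t q B x = 1 - q ^ vac B M := by
  induction M with
  | zero => simp [vac]
  | succ M ih =>
    rw [Finset.sum_range_succ, ih, vac, t]
    split_ifs
    · simp
    · rw [pow_succ]; ring

lemma t_hasSum {q : ℝ} (h0 : 0 < q) (h1 : q < 1) (B : Finset ℕ) : HasSum (t q B) 1 := by
  rw [hasSum_iff_tendsto_nat_of_nonneg (t_nonneg h0 h1 B)]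
  simp only [t_sum]
  have hv : Filter.Tendsto (vac B) Filter.atTop Filter.atTop := by
    refine Filter.tendsto_atTop_mono (f := fun M => M - B.card) (fun M => ?_)
      (Filter.tendsto_sub_atTop_nat _)
    have := vac_add B M
    have h2 : (B.filter (· < M)).card ≤ B.card := Finset.card_filter_le _ _
    show M - B.card ≤ vac B M
    omega
  have := (tendsto_pow_atTop_nhds_zero_of_lt_one h0.le h1).comp hv
  simpa using this.const_sub 1

lemma T_summable {q : ℝ} (h0 : 0 < q) (h1 : q < 1) (φ : Finset ℕ → ℝ) (hφ : ∀ B, |φ B| ≤ 1) (B : Finset ℕ) :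
    Summable (fun x => t q B x * φ (insert x B)) := by
  refine Summable.of_norm_bounded (t_hasSum h0 h1 B).summable (fun x => ?_)
  rw [Real.norm_eq_abs, abs_mul, abs_of_nonneg (t_nonneg h0 h1 B x)]
  exact mul_le_of_le_one_right (t_nonneg h0 h1 B x) (hφ _)

lemma T_bound {q : ℝ} (h0 : 0 < q) (h1 : q < 1) (φ : Finset ℕ → ℝ) (hφ : ∀ B, |φ B| ≤ 1) (B : Finset ℕ) : |T q φ B| ≤ 1 := by
  unfold T
  rw [← Real.norm_eq_abs]
  refine tsum_of_norm_bounded (t_hasSum h0 h1 B) (fun x => ?_)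
  rw [Real.norm_eq_abs, abs_mul, abs_of_nonneg (t_nonneg h0 h1 B x)]
  exact mul_le_of_le_one_right (t_nonneg h0 h1 B x) (hφ _)

lemma K_bound {q : ℝ} (h0 : 0 < q) (h1 : q < 1) (φ : Finset ℕ → ℝ) (hφ : ∀ B, |φ B| ≤ 1) (B : Finset ℕ) : |K q φ B| ≤ 1 := by
  unfold K
  split_ifs
  · exact T_bound h0 h1 φ hφ _
  · exact hφ _

lemma t_zero {q : ℝ} (B : Finset ℕ) : t q B 0 = if 0 ∈ B then 0 else 1 - q := by
  simp [t, vac]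

lemma t_succ {q : ℝ} (B : Finset ℕ) (x : ℕ) : t q B (x + 1) = (if 0 ∈ B then 1 else q) * t q (sg B) x := by
  simp only [t, mem_sg, vac_shift]
  split_ifs <;> simp [pow_succ] <;> ring

lemma TK {q : ℝ} (h0 : 0 < q) (h1 : q < 1) (φ : Finset ℕ → ℝ) (hφ : ∀ B, |φ B| ≤ 1) : T q (K q φ) = K q (T q φ) := by
  funext B
  rw [T, (T_summable h0 h1 _ (K_bound h0 h1 φ hφ) B).tsum_eq_zero_add, t_zero]
  simp only [t_succ]
  by_cases h : 0 ∈ B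
  · simp only [K, h, if_true, sg_ins, Finset.mem_insert, or_true, zero_mul, zero_add, one_mul]
    rfl
  · have h' : ∀ x, ¬ (0 = x + 1) := by intro x; omega
    simp only [K, h, h', if_false, sg_ins, Finset.mem_insert, or_false, if_true, sg_ins0,
      mul_assoc]
    rw [tsum_mul_left, ← T]; ring

lemma Kit_bound {q : ℝ} (h0 : 0 < q) (h1 : q < 1) (φ : Finset ℕ → ℝ) (hφ : ∀ B, |φ B| ≤ 1) (j : ℕ) (B : Finset ℕ) :
    |(K q)^[j] φ B| ≤ 1 := by
  induction j generalizing B with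
  | zero => exact hφ B
  | succ j ih => rw [Function.iterate_succ_apply']; exact K_bound h0 h1 _ ih B

lemma TKit {q : ℝ} (h0 : 0 < q) (h1 : q < 1) (φ : Finset ℕ → ℝ) (hφ : ∀ B, |φ B| ≤ 1) (j : ℕ) :
    T q ((K q)^[j] φ) = (K q)^[j] (T q φ) := by
  induction j with
  | zero => rfl
  | succ j ih =>
    rw [Function.iterate_succ_apply', TK h0 h1 _ (Kit_bound h0 h1 φ hφ j), ih,
      Function.iterate_succ_apply']

lemma sg_sub {B : Finset ℕ} {j : ℕ} (h : B ⊆ Finset.range (j + 1)) : sg B ⊆ Finset.range j := by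
  intro x hx
  have := h ((mem_sg B x).1 hx)
  simpa using this

lemma K_exact {q : ℝ} (h0 : 0 < q) (h1 : q < 1) (j : ℕ) : ∀ (φ : Finset ℕ → ℝ) (_ : ∀ B, |φ B| ≤ 1) (B : Finset ℕ)
    (_ : B ⊆ Finset.range j), (K q)^[j] φ B = (T q)^[B.card] φ ∅ := by
  induction j with
  | zero =>
    intro φ hφ B hB
    have : B = ∅ := by simpa using hB
    subst this; rfl
  | succ j ih =>
    intro φ hφ B hB
    rw [Function.iterate_succ_apply', K]
    split_ifs with h
    · rw [TKit h0 h1 φ hφ, ih _ (T_bound h0 h1 φ hφ) _ (sg_sub hB), ← Function.iterate_succ_apply]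
      conv_rhs => rw [← up1_sg B h, card_up1]
    · rw [ih φ hφ _ (sg_sub hB)]
      conv_rhs => rw [← up_sg B h, card_up]

/-- unnormalised bounded stationary functional -/
def A (q : ℝ) : ℕ → ℕ → (Finset ℕ → ℝ) → ℝ
  | 0, 0, φ => φ ∅
  | 0, _ + 1, _ => 0
  | m + 1, 0, φ => A q m 0 (fun B => φ (up B))
  | m + 1, n + 1, φ => qAnalogue q (m - n + 1) * q ^ n * A q m n (fun B => φ (up1 B))
      + q ^ (n + 1) * A q m (n + 1) (fun B => φ (up B))

/-- truncated throw operator without the factor `1 - q` -/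
def Th (q : ℝ) (M : ℕ) (φ : Finset ℕ → ℝ) (B : Finset ℕ) : ℝ :=
  ∑ x ∈ Finset.range M, (if x ∈ B then 0 else q ^ vac B x) * φ (insert x B)

lemma A_add (q : ℝ) (m n : ℕ) (φ ψ : Finset ℕ → ℝ) :
    A q m n (fun B => φ B + ψ B) = A q m n φ + A q m n ψ := by
  induction m generalizing n φ ψ with
  | zero => cases n <;> simp [A]
  | succ m ih =>
    cases n with
    | zero => simp only [A]; exact ih _ _ _
    | succ n =>
      simp only [A]
      rw [ih n (fun B => φ (up1 B)) (fun B => ψ (up1 B)),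
        ih (n+1) (fun B => φ (up B)) (fun B => ψ (up B))]
      ring

lemma A_smul (q : ℝ) (m n : ℕ) (c : ℝ) (φ : Finset ℕ → ℝ) :
    A q m n (fun B => c * φ B) = c * A q m n φ := by
  induction m generalizing n φ with
  | zero => cases n <;> simp [A]
  | succ m ih =>
    cases n with
    | zero => simp only [A]; exact ih _ _
    | succ n =>
      simp only [A]
      rw [ih n (fun B => φ (up1 B)), ih (n+1) (fun B => φ (up B))]
      ring

lemma A_zero (q : ℝ) (m : ℕ) (φ : Finset ℕ → ℝ) : A q m 0 φ = φ ∅ := by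
  induction m generalizing φ with
  | zero => rfl
  | succ m ih => rw [A, ih]; rfl

lemma A_gt (q : ℝ) (m n : ℕ) (h : m < n) (φ : Finset ℕ → ℝ) : A q m n φ = 0 := by
  induction m generalizing n φ with
  | zero => cases n with
    | zero => omega
    | succ n => simp [A]
  | succ m ih =>
    cases n with
    | zero => omega
    | succ n => simp only [A]; rw [ih n (by omega), ih (n+1) (by omega)]; ring

lemma Th_up1 (q : ℝ) (M : ℕ) (φ : Finset ℕ → ℝ) (B : Finset ℕ) :
    Th q (M + 1) φ (up1 B) = Th q M (fun C => φ (up1 C)) B := by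
  rw [Th, Finset.sum_range_succ', Th]
  simp [zero_up1, succ_up1, vac_shift, sg_up1, up1_ins]

lemma Th_up (q : ℝ) (M : ℕ) (φ : Finset ℕ → ℝ) (B : Finset ℕ) :
    Th q (M + 1) φ (up B) = φ (up1 B) + q * Th q M (fun C => φ (up C)) B := by
  rw [Th, Finset.sum_range_succ', Th, Finset.mul_sum, add_comm]
  congr 1
  · simp [zero_up, vac, up1]
  · refine Finset.sum_congr rfl fun x _ => ?_
    simp only [zero_up, succ_up, vac_shift, sg_up, up_ins, if_false]
    split_ifs
    · simp
    · ring

lemma qA_succ {q : ℝ} (h : q ≠ 1) (k : ℕ) : qAnalogue q (k + 1) = 1 + q * qAnalogue q k := by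
  have : 1 - q ≠ 0 := sub_ne_zero.2 (Ne.symm h)
  unfold qAnalogue
  field_simp
  ring

lemma A_stat {q : ℝ} (h : q ≠ 1) (m n : ℕ) (φ : Finset ℕ → ℝ) :
    A q (m + 1) (n + 1) φ = q ^ n * A q m n (Th q (m + 1) φ) + q ^ (n + 1) * A q m (n + 1) φ := by
  induction m generalizing n φ with
  | zero =>
    cases n with
    | zero =>
      have : 1 - q ≠ 0 := sub_ne_zero.2 (Ne.symm h)
      simp [A, Th, vac, qAnalogue, up1, up, this]
    | succ n => simp [A]
  | succ m ih =>
    rw [A]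
    cases n with
    | zero =>
      have hf : (fun B => Th q (m + 1 + 1) φ (up B)) =
        fun B => φ (up1 B) + q * Th q (m + 1) (fun C => φ (up C)) B := by
          funext B; exact Th_up _ _ _ _
      rw [ih 0 (fun B => φ (up B)), A, A, A, hf, A_add, A_smul]
      rw [Nat.sub_zero, Nat.sub_zero, qA_succ h (m + 1)]
      simp only [A_zero, show up ∅ = ∅ from rfl]
      ring
    | succ n =>
      have hf : (fun B => Th q (m + 1 + 1) φ (up B)) =
        fun B => φ (up1 B) + q * Th q (m + 1) (fun C => φ (up C)) B := by
          funext B; exact Th_up _ _ _ _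
      have hf1 : (fun B => Th q (m + 1 + 1) φ (up1 B)) =
        fun B => Th q (m + 1) (fun C => φ (up1 C)) B := by
          funext B; exact Th_up1 _ _ _ _
      rw [ih (n+1) (fun B => φ (up B)), ih n (fun B => φ (up1 B)), A, A, hf, hf1, A_add, A_smul]
      by_cases hmn : m < n + 1
      · rw [A_gt q m (n+1) hmn, A_gt q m (n+1) hmn]
        rw [show m + 1 - (n + 1) + 1 = m - n + 1 by omega]
        ring
      · rw [show m + 1 - (n + 1) + 1 = m - n + 1 by omega,
         show m - (n + 1) + 1 = m - n by omega, qA_succ h (m - n)]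
        ring

lemma up_sub {B : Finset ℕ} {m : ℕ} (h : B ⊆ Finset.range m) : up B ⊆ Finset.range (m + 1) := by
  intro x hx
  cases x with
  | zero => simp
  | succ x => have := h ((succ_up B x).1 hx); simpa using this

lemma up1_sub {B : Finset ℕ} {m : ℕ} (h : B ⊆ Finset.range m) : up1 B ⊆ Finset.range (m + 1) := by
  intro x hx
  cases x with
  | zero => simp
  | succ x => have := h ((succ_up1 B x).1 hx); simpa using this

lemma vB_up (m : ℕ) (B : Finset ℕ) (x : ℕ) : vB (m + 1) (up B) (x + 1) = vB m B x := by
  unfold vB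
  rw [← card_up (Finset.Ico x m \ B)]
  congr 1
  ext y; cases y <;> simp [zero_up, succ_up]

lemma vB_up1 (m : ℕ) (B : Finset ℕ) (x : ℕ) : vB (m + 1) (up1 B) (x + 1) = vB m B x := by
  unfold vB
  rw [← card_up (Finset.Ico x m \ B)]
  congr 1
  ext y; cases y <;> simp [zero_up, succ_up, succ_up1]

lemma W_up (m : ℕ) (q : ℝ) (B : Finset ℕ) : W (m + 1) q (up B) = q ^ B.card * W m q B := by
  unfold W
  rw [up, Finset.prod_image (Nat.succ_injective.injOn), ← up, ← Finset.prod_const,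
    ← Finset.prod_mul_distrib]
  refine Finset.prod_congr rfl fun x _ => ?_
  rw [Nat.succ_eq_add_one, vB_up, pow_succ]; ring

lemma W_up1 (m : ℕ) (q : ℝ) (B : Finset ℕ) (h : B ⊆ Finset.range m) :
    W (m + 1) q (up1 B) = qAnalogue q (m - B.card + 1) * q ^ B.card * W m q B := by
  have h0 : vB (m + 1) (up1 B) 0 = m - B.card := by
    unfold vB
    rw [Finset.card_sdiff_of_subset, card_up1]
    · simp
    · rw [← Finset.range_eq_Ico]; exact up1_sub h
  unfold W
  rw [show ∏ x ∈ up1 B, qAnalogue q (1 + vB (m + 1) (up1 B) x) * q ^ x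
    = ∏ x ∈ insert 0 (up B), qAnalogue q (1 + vB (m + 1) (up1 B) x) * q ^ x from rfl]
  rw [Finset.prod_insert (zero_up B), h0,
    up, Finset.prod_image (Nat.succ_injective.injOn), mul_assoc (qAnalogue q (m - B.card + 1)),
    ← Finset.prod_const, ← Finset.prod_mul_distrib, pow_zero, mul_one, add_comm 1]
  congr 1
  refine Finset.prod_congr rfl fun x _ => ?_
  rw [Nat.succ_eq_add_one, vB_up1, pow_succ]; ring

lemma A_sum (q : ℝ) (m n : ℕ) (φ : Finset ℕ → ℝ) :
    A q m n φ = ∑ B ∈ Finset.powersetCard n (Finset.range m), W m q B * φ B := by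
  induction m generalizing n φ with
  | zero =>
    cases n with
    | zero => simp [A, W]
    | succ n =>
      rw [A, Finset.powersetCard_eq_empty.2 (by simp), Finset.sum_empty]
  | succ m ih =>
    cases n with
    | zero => simp [A_zero, W]
    | succ n =>
      rw [A, ih, ih, ← Finset.sum_filter_add_sum_filter_not
        (Finset.powersetCard (n+1) (Finset.range (m+1))) (fun B => 0 ∈ B), Finset.mul_sum,
        Finset.mul_sum]
      congr 1
      · refine Finset.sum_bij' (fun B _ => up1 B) (fun B _ => sg B) ?_ ?_ ?_ ?_ ?_
        · intro B hB
          rw [Finset.mem_powersetCard] at hB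
          simp only [Finset.mem_filter, Finset.mem_powersetCard]
          exact ⟨⟨up1_sub hB.1, by rw [card_up1, hB.2]⟩, zero_up1 B⟩
        · intro B hB
          simp only [Finset.mem_filter, Finset.mem_powersetCard] at hB ⊢
          refine ⟨sg_sub hB.1.1, ?_⟩
          have := card_up1 (sg B)
          rw [up1_sg B hB.2] at this
          omega
        · intro B _; exact sg_up1 B
        · intro B hB
          simp only [Finset.mem_filter] at hB
          exact up1_sg B hB.2
        · intro B hB
          rw [Finset.mem_powersetCard] at hB
          rw [W_up1 m q B hB.1, hB.2]; ring
      · refine Finset.sum_bij' (fun B _ => up B) (fun B _ => sg B) ?_ ?_ ?_ ?_ ?_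
        · intro B hB
          rw [Finset.mem_powersetCard] at hB
          simp only [Finset.mem_filter, Finset.mem_powersetCard]
          exact ⟨⟨up_sub hB.1, by rw [card_up, hB.2]⟩, zero_up B⟩
        · intro B hB
          simp only [Finset.mem_filter, Finset.mem_powersetCard] at hB ⊢
          refine ⟨sg_sub hB.1.1, ?_⟩
          have := card_up (sg B)
          rw [up_sg B hB.2] at this
          omega
        · intro B _; exact sg_up B
        · intro B hB
          simp only [Finset.mem_filter] at hB
          exact up_sg B hB.2
        · intro B hB
          rw [Finset.mem_powersetCard] at hB
          rw [W_up m q B, hB.2]; ring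

lemma qS_gt (q : ℝ) (a b : ℕ) (h : a < b) : qStirling q a b = 0 := by
  induction a generalizing b with
  | zero => cases b with
    | zero => omega
    | succ b => simp [qStirling]
  | succ a ih => cases b with
    | zero => omega
    | succ b => rw [qStirling, ih b (by omega), ih (b+1) (by omega)]; ring

lemma qA_inv {q : ℝ} (h0 : 0 < q) (h1 : q < 1) (d : ℕ) :
    qAnalogue (1 / q) (d + 1) = (1 / q) ^ d * qAnalogue q (d + 1) := by
  have h2 : 1 - q ≠ 0 := by linarith
  have h3 : q - 1 ≠ 0 := by linarith
  have h4 : 1 - 1 / q ≠ 0 := by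
    rw [ne_eq, sub_eq_zero, eq_comm, div_eq_one_iff_eq h0.ne']; linarith
  unfold qAnalogue
  rw [div_eq_iff h4]
  simp only [div_pow, one_pow]
  field_simp
  ring

lemma choose2 (m : ℕ) : (((m + 2).choose 2 : ℕ) : ℤ) = ((m + 1).choose 2 : ℕ) + m + 1 := by
  have := Nat.choose_succ_succ (m + 1) 1
  simp only [Nat.succ_eq_add_one, Nat.choose_one_right] at this
  rw [show m + 2 = m + 1 + 1 by ring, this]; push_cast; ring

lemma A_one {q : ℝ} (h0 : 0 < q) (h1 : q < 1) (m n : ℕ) (h : n ≤ m) :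
    A q m n (fun _ => 1) = Zval m n q := by
  induction m generalizing n with
  | zero =>
    have : n = 0 := by omega
    subst this
    simp [A, Zval, qStirling]
  | succ m ih =>
    have hz : q ≠ 0 := h0.ne'
    cases n with
    | zero =>
      rw [A, ih 0 (by omega), Zval, Zval]
      simp only [Nat.sub_zero]
      rw [qStirling.eq_4 (1 / q) (m + 1) (m + 1), qS_gt _ (m+1) (m+1+1) (by omega), choose2, one_div, inv_pow]
      simp only [Nat.cast_zero, sub_zero, mul_zero, add_zero]
      rw [show (((m+1).choose 2 : ℕ) : ℤ) + m + 1 = ((m+1).choose 2 : ℕ) + ((m + 1 : ℕ) : ℤ) by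
        push_cast; ring, zpow_add₀ hz, zpow_natCast q (m + 1)]
      field_simp
    | succ n =>
      obtain ⟨d, rfl⟩ : ∃ d, m = n + d := ⟨m - n, by omega⟩
      have hZ : Zval (n + d + 1) (n + 1) q = q ^ (((n + d + 1).choose 2 : ℕ) : ℤ) *
          (qStirling (1/q) (n + d + 1) d
            + qAnalogue q (d + 1) * qStirling (1/q) (n + d + 1) (d + 1)) := by
        rw [Zval, show n + d + 1 - (n + 1) + 1 = d + 1 by omega, qStirling, qA_inv h0 h1, choose2,
          show (((n + d + 1).choose 2 : ℕ) : ℤ) + ((n + d : ℕ) : ℤ) + 1 - ((n + 1 : ℕ) : ℤ)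
            = (((n + d + 1).choose 2 : ℕ) : ℤ) + (d : ℤ) by push_cast; ring,
          zpow_add₀ hz, zpow_natCast, zpow_natCast, one_div, inv_pow]
        field_simp
      rw [A, ih n (by omega), hZ, Zval, show n + d - n + 1 = d + 1 by omega, zpow_sub₀ hz]
      simp only [zpow_natCast]
      cases d with
      | zero =>
        rw [A_gt _ _ _ (by omega)]
        simp only [qStirling]
        field_simp
        ring
      | succ d =>
        rw [ih (n+1) (by omega), Zval, show n + (d + 1) - (n + 1) + 1 = d + 1 by omega,
          zpow_sub₀ hz]
        simp only [zpow_natCast]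
        field_simp
        ring

lemma qA_nonneg {q : ℝ} (h0 : 0 < q) (h1 : q < 1) (k : ℕ) : 0 ≤ qAnalogue q k :=
  div_nonneg (by linarith [pow_le_one₀ (n := k) h0.le h1.le]) (by linarith)

lemma qA_pos {q : ℝ} (h0 : 0 < q) (h1 : q < 1) (k : ℕ) : 0 < qAnalogue q (k + 1) :=
  div_pos (by linarith [pow_lt_one₀ (n := k + 1) h0.le h1 (by omega)]) (by linarith)

lemma W_nonneg {q : ℝ} (h0 : 0 < q) (h1 : q < 1) (m : ℕ) (B : Finset ℕ) : 0 ≤ W m q B :=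
  Finset.prod_nonneg fun x _ => mul_nonneg (qA_nonneg h0 h1 _) (by positivity)

lemma A_bound {q : ℝ} (h0 : 0 < q) (h1 : q < 1) (m n : ℕ) (φ : Finset ℕ → ℝ) (c : ℝ)
    (h : ∀ B ⊆ Finset.range m, B.card = n → |φ B| ≤ c) :
    |A q m n φ| ≤ c * A q m n (fun _ => 1) := by
  rw [A_sum, A_sum, Finset.mul_sum]
  refine (Finset.abs_sum_le_sum_abs _ _).trans (Finset.sum_le_sum fun B hB => ?_)
  rw [Finset.mem_powersetCard] at hB
  rw [abs_mul, abs_of_nonneg (W_nonneg h0 h1 m B), mul_one, mul_comm]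
  exact mul_le_mul_of_nonneg_right (h B hB.1 hB.2) (W_nonneg h0 h1 m B)

lemma A_one_nonneg {q : ℝ} (h0 : 0 < q) (h1 : q < 1) (m n : ℕ) : 0 ≤ A q m n (fun _ => 1) := by
  rw [A_sum]
  exact Finset.sum_nonneg fun B _ => by simpa using W_nonneg h0 h1 m B

lemma A_one_pos {q : ℝ} (h0 : 0 < q) (h1 : q < 1) (m n : ℕ) (h : n ≤ m) :
    0 < A q m n (fun _ => 1) := by
  induction m generalizing n with
  | zero =>
    have : n = 0 := by omega
    subst this
    simp [A]
  | succ m ih =>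
    cases n with
    | zero => simp [A_zero]
    | succ n =>
      rw [A]
      have := ih n (by omega)
      have := A_one_nonneg h0 h1 m (n+1)
      have := qA_pos h0 h1 (m - n)
      positivity

lemma Th_diff {q : ℝ} (h0 : 0 < q) (h1 : q < 1) (m n : ℕ) (hnm : n ≤ m) (φ : Finset ℕ → ℝ)
    (hφ : ∀ B, |φ B| ≤ 1) (B : Finset ℕ) (hB : B ⊆ Finset.range m) (hc : B.card = n) :
    |Th q (m + 1) φ B - qAnalogue q (m - n + 1) * T q φ B|
      ≤ 2 * q ^ (m - n + 1) * qAnalogue q (m - n + 1) := by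
  have hv : vac B (m + 1) = m - n + 1 := by
    have := vac_sub B (m + 1) (hB.trans (Finset.range_subset_range.2 (by omega)))
    omega
  set l := m - n + 1 with hl
  have hq : 0 < 1 - q := by linarith
  set S := ∑ x ∈ Finset.range (m + 1), t q B x * φ (insert x B) with hS
  set R := ∑' x, t q B (x + (m + 1)) * φ (insert (x + (m + 1)) B) with hR
  have hT : T q φ B = S + R := ((T_summable h0 h1 φ hφ B).sum_add_tsum_nat_add (m + 1)).symm
  have hTh : Th q (m + 1) φ B = S / (1 - q) := by
    rw [eq_div_iff hq.ne', Th, hS, Finset.sum_mul]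
    refine Finset.sum_congr rfl fun x _ => ?_
    unfold t; split_ifs
    · simp
    · ring
  have hSb : |S| ≤ 1 - q ^ l := by
    rw [← hv, ← t_sum]
    refine (Finset.abs_sum_le_sum_abs _ _).trans (Finset.sum_le_sum fun x _ => ?_)
    rw [abs_mul, abs_of_nonneg (t_nonneg h0 h1 B x)]
    exact mul_le_of_le_one_right (t_nonneg h0 h1 B x) (hφ _)
  have hRb : |R| ≤ q ^ l := by
    have hs : HasSum (fun x => t q B (x + (m + 1))) (q ^ l) := by
      rw [hasSum_nat_add_iff, t_sum, hv]
      simpa using t_hasSum h0 h1 B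
    rw [← Real.norm_eq_abs]
    refine tsum_of_norm_bounded hs (fun x => ?_)
    rw [Real.norm_eq_abs, abs_mul, abs_of_nonneg (t_nonneg h0 h1 B _)]
    exact mul_le_of_le_one_right (t_nonneg h0 h1 B _) (hφ _)
  have hql : 0 < q ^ l := by positivity
  have hql1 : q ^ l ≤ 1 := pow_le_one₀ h0.le h1.le
  rw [hT, hTh, show S / (1 - q) - qAnalogue q l * (S + R)
    = (q ^ l * S - (1 - q ^ l) * R) / (1 - q) by unfold qAnalogue; field_simp; ring,
    qAnalogue, ← mul_div_assoc, abs_div, abs_of_pos hq]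
  refine div_le_div_of_nonneg_right ?_ hq.le
  refine (abs_sub _ _).trans ?_
  rw [abs_mul, abs_mul, abs_of_pos hql, abs_of_nonneg (by linarith : 0 ≤ 1 - q ^ l)]
  have a1 := mul_le_mul_of_nonneg_left hSb hql.le
  have a2 := mul_le_mul_of_nonneg_left hRb (by linarith : 0 ≤ 1 - q ^ l)
  nlinarith

lemma step {q : ℝ} (h0 : 0 < q) (h1 : q < 1) (m n : ℕ) (hnm : n ≤ m) (φ : Finset ℕ → ℝ)
    (hφ : ∀ B, |φ B| ≤ 1) :
    |A q (m + 1) (n + 1) φ - A q (m + 1) (n + 1) (K q φ)|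
      ≤ 2 * q ^ (m - n + 1) * A q (m + 1) (n + 1) (fun _ => 1) := by
  have e1 : (fun B => K q φ (up1 B)) = T q φ := by
    funext B; simp [K, zero_up1, sg_up1]
  have e2 : (fun B => K q φ (up B)) = φ := by
    funext B; simp [K, zero_up, sg_up]
  have e3 : A q m n (fun B => Th q (m + 1) φ B - qAnalogue q (m - n + 1) * T q φ B)
      = A q m n (Th q (m + 1) φ) - qAnalogue q (m - n + 1) * A q m n (T q φ) := by
    have := A_add q m n (Th q (m + 1) φ) (fun B => (- qAnalogue q (m - n + 1)) * T q φ B)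
    rw [A_smul] at this
    rw [show (fun B => Th q (m + 1) φ B - qAnalogue q (m - n + 1) * T q φ B)
      = fun B => Th q (m + 1) φ B + (- qAnalogue q (m - n + 1)) * T q φ B by funext B; ring, this]
    ring
  have b := A_bound h0 h1 m n _ _ (Th_diff h0 h1 m n hnm φ hφ)
  rw [e3] at b
  rw [A_stat h1.ne, A, e1, e2, show q ^ n * A q m n (Th q (m + 1) φ) + q ^ (n + 1) * A q m (n + 1) φ
    - (qAnalogue q (m - n + 1) * q ^ n * A q m n (T q φ) + q ^ (n + 1) * A q m (n + 1) φ)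
    = q ^ n * (A q m n (Th q (m + 1) φ) - qAnalogue q (m - n + 1) * A q m n (T q φ)) by ring,
    abs_mul, abs_of_pos (by positivity)]
  refine (mul_le_mul_of_nonneg_left b (by positivity)).trans ?_
  rw [A]
  have : 0 ≤ 2 * q ^ (m - n + 1) * (q ^ (n + 1) * A q m (n + 1) (fun _ => 1)) := by
    have := A_one_nonneg h0 h1 m (n+1)
    positivity
  linarith

lemma main_A {q : ℝ} (h0 : 0 < q) (h1 : q < 1) (m n : ℕ) (hnm : n ≤ m) (φ : Finset ℕ → ℝ)
    (hφ : ∀ B, |φ B| ≤ 1) :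
    |A q (m + 1) (n + 1) φ - (T q)^[n + 1] φ ∅ * A q (m + 1) (n + 1) (fun _ => 1)|
      ≤ (m + 1 : ℕ) * (2 * q ^ (m - n + 1) * A q (m + 1) (n + 1) (fun _ => 1)) := by
  have key : ∀ j : ℕ, |A q (m + 1) (n + 1) φ - A q (m + 1) (n + 1) ((K q)^[j] φ)|
      ≤ (j : ℕ) * (2 * q ^ (m - n + 1) * A q (m + 1) (n + 1) (fun _ => 1)) := by
    intro j
    induction j with
    | zero => simp
    | succ j ih =>
      have := step h0 h1 m n hnm _ (Kit_bound h0 h1 φ hφ j)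
      rw [Function.iterate_succ_apply']
      refine (abs_sub_le _ _ _).trans ((add_le_add ih this).trans ?_)
      push_cast
      linarith
  have := key (m + 1)
  have e : A q (m + 1) (n + 1) ((K q)^[m + 1] φ)
      = (T q)^[n + 1] φ ∅ * A q (m + 1) (n + 1) (fun _ => 1) := by
    rw [A_sum, A_sum, Finset.mul_sum]
    refine Finset.sum_congr rfl fun B hB => ?_
    rw [Finset.mem_powersetCard] at hB
    rw [K_exact h0 h1 _ φ hφ B hB.1, hB.2]; ring
  rwa [e] at this

/-- unbounded distribution on all finsets -/
def P (n : ℕ) (q : ℝ) (B : Finset ℕ) : ℝ := if B.card = n then piUnbdd n q B else 0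

lemma rank_sum {q : ℝ} (h0 : 0 < q) (C : Finset ℕ) :
    ∑ x ∈ C, q ^ vac C x * (q⁻¹) ^ x = ∑ r ∈ Finset.range C.card, (q⁻¹) ^ r := by
  induction C using Finset.induction_on_max with
  | empty => simp
  | insert a C ha ih =>
    have hn : a ∉ C := fun h => lt_irrefl _ (ha a h)
    rw [Finset.sum_insert hn, Finset.card_insert_of_notMem hn, Finset.sum_range_succ, ← ih,
      add_comm]
    congr 1
    · refine Finset.sum_congr rfl fun x hx => ?_
      rw [vac_congr (insert a C) C x]
      intro y hy
      have := ha x hx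
      simp only [Finset.mem_insert, or_iff_right_iff_imp]
      intro e; omega
    · rw [vac_congr (insert a C) C a (by
        intro y hy
        simp only [Finset.mem_insert, or_iff_right_iff_imp]
        intro e; omega)]
      have := vac_sub C a (fun x hx => by simpa using ha x hx)
      conv_lhs => rw [← this]
      rw [show vac C (vac C a + C.card) = vac C a by rw [this], pow_add, ← mul_assoc, ← mul_pow,
        mul_inv_cancel₀ h0.ne', one_pow, one_mul]

lemma geom_inv {q : ℝ} (h0 : 0 < q) (n : ℕ) :
    (1 - q) * ∑ r ∈ Finset.range (n + 1), (q⁻¹) ^ r = (1 - q ^ (n + 1)) * (q⁻¹) ^ n := by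
  have hz := h0.ne'
  induction n with
  | zero => simp
  | succ n ih =>
    rw [Finset.sum_range_succ, mul_add, ih]
    simp only [inv_pow]
    field_simp
    ring

lemma P_rec {q : ℝ} (h0 : 0 < q) (n : ℕ) (C : Finset ℕ) :
    ∑ x ∈ C, P n q (C.erase x) * t q (C.erase x) x = P (n + 1) q C := by
  have hz := h0.ne'
  by_cases hC : C.card = n + 1
  · have e : ∀ x ∈ C, P n q (C.erase x) * t q (C.erase x) x =
        (∏ k ∈ Finset.Icc 1 n, (1 - q ^ k)) * q ^ (-(n.choose 2 : ℤ)) * (∏ x ∈ C, q ^ x)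
          * (1 - q) * (q ^ vac C x * (q⁻¹) ^ x) := by
      intro x hx
      have hc : (C.erase x).card = n := by rw [Finset.card_erase_of_mem hx, hC]; rfl
      rw [P, if_pos hc, t, if_neg (by simp), piUnbdd, ← Finset.mul_prod_erase C _ hx,
        vac_congr (C.erase x) C x (by intro y hy; simp [hy.ne])]
      simp only [inv_pow]
      field_simp
    rw [Finset.sum_congr rfl e, ← Finset.mul_sum, rank_sum h0, hC, P, if_pos hC, piUnbdd,
      mul_assoc _ (1 - q), geom_inv h0, Finset.prod_Icc_succ_top (by omega)]
    have : (((n + 1).choose 2 : ℕ) : ℤ) = (n.choose 2 : ℕ) + n := by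
      have := Nat.choose_succ_succ n 1
      simp only [Nat.succ_eq_add_one, Nat.choose_one_right] at this
      rw [this]; push_cast; ring
    rw [this, neg_add, zpow_add₀ hz, zpow_neg q n, zpow_natCast, inv_pow]
    ring
  · rw [P, if_neg hC]
    refine Finset.sum_eq_zero fun x hx => ?_
    have h2 := Finset.card_pos.2 ⟨x, hx⟩
    rw [P, if_neg, zero_mul]
    rw [Finset.card_erase_of_mem hx]; omega

lemma P_nonneg {q : ℝ} (h0 : 0 < q) (h1 : q < 1) (n : ℕ) (B : Finset ℕ) : 0 ≤ P n q B := by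
  unfold P piUnbdd
  split_ifs
  · have : 0 ≤ ∏ k ∈ Finset.Icc 1 n, (1 - q ^ k) :=
      Finset.prod_nonneg fun k _ => by linarith [pow_le_one₀ (n := k) h0.le h1.le]
    have : 0 ≤ ∏ x ∈ B, q ^ x := Finset.prod_nonneg fun k _ => by positivity
    positivity
  · rfl

/-- toggle x in B -/
def tog : Finset ℕ × ℕ ≃ Finset ℕ × ℕ :=
  Function.Involutive.toPerm (fun p => (symmDiff p.1 {p.2}, p.2)) (by
    intro p; simp [symmDiff_symmDiff_cancel_right])

lemma tog_apply (C : Finset ℕ) (x : ℕ) : tog (C, x) = (symmDiff C {x}, x) := rfl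

lemma P_hasSum {q : ℝ} (h0 : 0 < q) (h1 : q < 1) (n : ℕ) : ∀ (φ : Finset ℕ → ℝ)
    (_ : ∀ B, |φ B| ≤ 1), HasSum (fun B => P n q B * φ B) ((T q)^[n] φ ∅) := by
  induction n with
  | zero =>
    intro φ hφ
    have : (fun B => P 0 q B * φ B) = fun B => if B = ∅ then φ ∅ else 0 := by
      funext B
      by_cases h : B = ∅
      · subst h; simp [P, piUnbdd]
      · simp [P, h]
    rw [this]
    exact hasSum_ite_eq _ _
  | succ n ih =>
    intro φ hφ
    rw [Function.iterate_succ_apply]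
    have hT := ih _ (T_bound h0 h1 φ hφ)
    have hP : Summable (P n q) := by
      simpa using (ih (fun _ => 1) (by simp)).summable
    let F : Finset ℕ × ℕ → ℝ := fun p => P n q p.1 * (t q p.1 p.2 * φ (insert p.2 p.1))
    have hs : Summable (fun p : Finset ℕ × ℕ => P n q p.1 * t q p.1 p.2) := by
      rw [summable_prod_of_nonneg
        (fun p => mul_nonneg (P_nonneg h0 h1 _ _) (t_nonneg h0 h1 _ _))]
      have hfs : ∀ B, Summable (fun x => P n q B * t q B x) :=
        fun B => Summable.mul_left (P n q B) (t_hasSum h0 h1 B).summable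
      refine ⟨hfs, ?_⟩
      have : (fun B => ∑' x, P n q B * t q B x) = P n q := by
        funext B
        rw [tsum_mul_left, (t_hasSum h0 h1 B).tsum_eq, mul_one]
      show Summable (fun B => ∑' x, P n q B * t q B x)
      rw [this]; exact hP
    have hF : Summable F := by
      refine Summable.of_norm_bounded hs (fun p => ?_)
      simp only [F]
      rw [Real.norm_eq_abs, abs_mul, abs_mul, abs_of_nonneg (t_nonneg h0 h1 _ _),
        abs_of_nonneg (P_nonneg h0 h1 _ _)]
      exact mul_le_mul_of_nonneg_left
        (mul_le_of_le_one_right (t_nonneg h0 h1 _ _) (hφ _)) (P_nonneg h0 h1 _ _)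
    have hfib : ∀ B, HasSum (fun x => F (B, x)) (P n q B * T q φ B) :=
      fun B => ((T_summable h0 h1 φ hφ B).hasSum.mul_left (P n q B))
    have hF1 : HasSum (fun B => P n q B * T q φ B) (∑' p, F p) :=
      HasSum.prod_fiberwise hF.hasSum hfib
    have hv : ∑' p, F p = (T q)^[n] (T q φ) ∅ := hF1.unique hT
    have hF2 : HasSum F ((T q)^[n] (T q φ) ∅) := by rw [← hv]; exact hF.hasSum
    rw [← tog.hasSum_iff] at hF2
    refine hF2.prod_fiberwise (fun C => ?_)
    rw [← P_rec h0, Finset.sum_mul]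
    have : ∀ x ∈ C, P n q (C.erase x) * t q (C.erase x) x * φ C = (F ∘ tog) (C, x) := by
      intro x hx
      have e : symmDiff C {x} = C.erase x := by
        ext y; simp only [Finset.mem_symmDiff, Finset.mem_singleton, Finset.mem_erase]
        constructor
        · rintro (⟨a, b⟩ | ⟨a, b⟩)
          · exact ⟨b, a⟩
          · subst a; exact absurd hx b
        · rintro ⟨a, b⟩; exact Or.inl ⟨b, a⟩
      simp only [F, tog_apply, Function.comp, e, Finset.insert_erase hx]
      ring
    rw [Finset.sum_congr rfl this]
    refine hasSum_sum_of_ne_finset_zero fun x hx => ?_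
    have : x ∈ symmDiff C {x} := by simp [Finset.mem_symmDiff, hx]
    simp only [F, tog_apply, Function.comp, t, this, if_true]
    ring

lemma final {q : ℝ} (h0 : 0 < q) (h1 : q < 1) (m n : ℕ) (hnm : n ≤ m) :
    (1 / 2) * ∑' B : {B : Finset ℕ // B.card = n + 1},
        |piBdd (m + 1) (n + 1) q B.val - piUnbdd (n + 1) q B.val|
      ≤ ((m + 1 : ℕ) : ℝ) * q ^ (m - n + 1) := by
  let D : Finset ℕ → ℝ := fun B => piBdd (m + 1) (n + 1) q B - piUnbdd (n + 1) q B
  let φ : Finset ℕ → ℝ := fun B => if 0 ≤ D B then 1 else -1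
  have hφ : ∀ B, |φ B| ≤ 1 := by
    intro B; simp only [φ]; split_ifs <;> simp
  have hD : ∀ B, |D B| = D B * φ B := by
    intro B; simp only [φ]; split_ifs with h
    · rw [abs_of_nonneg h, mul_one]
    · rw [abs_of_neg (by linarith)]; ring
  have hZ := A_one h0 h1 (m + 1) (n + 1) (by omega)
  have hZpos := A_one_pos h0 h1 (m + 1) (n + 1) (by omega)
  set Z := A q (m + 1) (n + 1) (fun _ => 1) with hZdef
  have hb : HasSum (fun B : Finset ℕ => if B.card = n + 1 then
      piBdd (m + 1) (n + 1) q B * φ B else 0) (A q (m + 1) (n + 1) φ / Z) := by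
    have : A q (m + 1) (n + 1) φ / Z = ∑ B ∈ Finset.powersetCard (n + 1) (Finset.range (m + 1)),
      (if B.card = n + 1 then piBdd (m + 1) (n + 1) q B * φ B else 0) := by
      rw [A_sum, Finset.sum_div]
      refine Finset.sum_congr rfl fun B hB => ?_
      rw [Finset.mem_powersetCard] at hB
      rw [if_pos hB.2, piBdd, if_pos hB.1, ← hZ]; ring
    rw [this]
    refine hasSum_sum_of_ne_finset_zero fun B hB => ?_
    rw [Finset.mem_powersetCard, not_and'] at hB
    split_ifs with h
    · rw [piBdd, if_neg (hB h), zero_mul]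
    · rfl
  have hu := P_hasSum h0 h1 (n + 1) φ hφ
  have hs := hb.sub hu
  have e : ∑' B : {B : Finset ℕ // B.card = n + 1},
        |piBdd (m + 1) (n + 1) q B.val - piUnbdd (n + 1) q B.val|
        = A q (m + 1) (n + 1) φ / Z - (T q)^[n + 1] φ ∅ := by
    rw [← hs.tsum_eq]
    refine (tsum_subtype {B : Finset ℕ | B.card = n + 1} (fun B => |D B|)).trans ?_
    refine tsum_congr fun B => ?_
    by_cases h : B.card = n + 1
    · rw [Set.indicator_of_mem (by exact h), hD, if_pos h, P, if_pos h]
      simp only [D]; ring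
    · rw [Set.indicator_of_notMem (by exact h), if_neg h, P, if_neg h]
      ring
  have hm := (abs_le.1 (main_A h0 h1 m n hnm φ hφ)).2
  rw [← hZdef] at hm
  have : A q (m + 1) (n + 1) φ / Z ≤ (T q)^[n + 1] φ ∅
      + ((m + 1 : ℕ) : ℝ) * (2 * q ^ (m - n + 1)) := by
    rw [div_le_iff₀ hZpos]; linarith
  rw [e]
  linarith

end JEP

/-- The total variation distance between the stationary distributions of the bounded and
unbounded geometric juggler's exclusion processes is at most `m * q^(m-n+1)`. -/
theorem tv_bound (m n : ℕ) (hn : 1 ≤ n) (hm : n ≤ m) (q : ℝ) (hq : q ∈ Set.Ioo (0 : ℝ) 1) :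
    (1 / 2) * ∑' B : {B : Finset ℕ // B.card = n},
        |piBdd m n q B.val - piUnbdd n q B.val| ≤ (m : ℝ) * q ^ (m - n + 1) := by
  obtain ⟨n, rfl⟩ : ∃ k, n = k + 1 := ⟨n - 1, by omega⟩
  obtain ⟨m, rfl⟩ : ∃ k, m = k + 1 := ⟨m - 1, by omega⟩
  rw [show m + 1 - (n + 1) + 1 = m - n + 1 by omega]
  exact JEP.final hq.1 hq.2 m n (by omega)
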